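/- Let h : ℝ → ℝ be three times continuously differentiable and let E, B be the fields defined from h. Then for every t ∈ ℝ, div E(t,·) = 0 and div B(t,·) = 0 on ℝ³ \ {0} (div acting in the spatial variable x). -/

import Mathlib

noncomputable section

open Real Set MeasureTheory

/-- Three dimensional Euclidean space. -/
abbrev R3 : Type := EuclideanSpace ℝ (Fin 3)

/-- The vector `(1,0,0)`. -/
def e1 : R3 := EuclideanSpace.single 0 1

/-- The cross product on `ℝ³`. -/
def cross3 (u v : R3) : R3 :=
  (WithLp.equiv 2 (Fin 3 → ℝ)).symm
    ![u 1 * v 2 - u 2 * v 1, u 2 * v 0 - u 0 * v 2, u 0 * v 1 - u 1 * v 0]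

/-- Partial derivative in the `i`-th coordinate direction. -/
def pd {E : Type*} [NormedAddCommGroup E] [NormedSpace ℝ E]
    (i : Fin 3) (f : R3 → E) (x : R3) : E :=
  fderiv ℝ f x (EuclideanSpace.single i 1)

/-- The curl of a vector field on `ℝ³`. -/
def curl3 (F : R3 → R3) (x : R3) : R3 :=
  (WithLp.equiv 2 (Fin 3 → ℝ)).symm
    ![pd 1 (fun y => F y 2) x - pd 2 (fun y => F y 1) x,
      pd 2 (fun y => F y 0) x - pd 0 (fun y => F y 2) x,
      pd 0 (fun y => F y 1) x - pd 1 (fun y => F y 0) x]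

/-- The divergence of a vector field on `ℝ³`. -/
def div3 (F : R3 → R3) (x : R3) : ℝ :=
  pd 0 (fun y => F y 0) x + pd 1 (fun y => F y 1) x + pd 2 (fun y => F y 2) x

/-- The electric field built from the profile `h`:
`E(t,x) = (h''(s)/|x| − h'(s)/|x|²) (n × e₁)` with `s = |x|+t`, `n = x/|x|`. -/
def Efield (h : ℝ → ℝ) (t : ℝ) (x : R3) : R3 :=
  (deriv (deriv h) (‖x‖ + t) / ‖x‖ - deriv h (‖x‖ + t) / ‖x‖ ^ 2) •
    cross3 (‖x‖⁻¹ • x) e1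

/-- The magnetic field built from the profile `h`:
`B(t,x) = −(h''(s)/|x| − 3h'(s)/|x|² + 3h(s)/|x|³)(n × (n × e₁)) + 2(h'(s)/|x|² − h(s)/|x|³) e₁`. -/
def Bfield (h : ℝ → ℝ) (t : ℝ) (x : R3) : R3 :=
  -(deriv (deriv h) (‖x‖ + t) / ‖x‖ - 3 * deriv h (‖x‖ + t) / ‖x‖ ^ 2
      + 3 * h (‖x‖ + t) / ‖x‖ ^ 3) •
    cross3 (‖x‖⁻¹ • x) (cross3 (‖x‖⁻¹ • x) e1)
  + (2 * (deriv h (‖x‖ + t) / ‖x‖ ^ 2 - h (‖x‖ + t) / ‖x‖ ^ 3)) • e1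

section Calculus

variable {f : R3 → ℝ} {x : R3}

theorem pd_eq_of_hasFDerivAt {f' : R3 →L[ℝ] ℝ} (hf : HasFDerivAt f f' x) (i : Fin 3) :
    pd i f x = f' (EuclideanSpace.single i 1) := by
  rw [pd, hf.fderiv]

theorem hasFDerivAt_coord (x : R3) (j : Fin 3) :
    HasFDerivAt (fun y : R3 => y j) (EuclideanSpace.proj j : R3 →L[ℝ] ℝ) x :=
  (EuclideanSpace.proj j : R3 →L[ℝ] ℝ).hasFDerivAt

theorem hasFDerivAt_norm_of_ne_zero (hx : x ≠ 0) :
    HasFDerivAt (fun y : R3 => ‖y‖) (‖x‖⁻¹ • innerSL ℝ x) x := by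
  have hsq := ((hasStrictFDerivAt_norm_sq x).hasFDerivAt).sqrt (by simpa using hx)
  simp only [Real.sqrt_sq (norm_nonneg _)] at hsq
  refine hsq.congr_fderiv ?_
  ext v
  simp
  ring

theorem hasFDerivAt_radial (hx : x ≠ 0) {k : ℝ → ℝ} {k' : ℝ} (hk : HasDerivAt k k' ‖x‖) :
    HasFDerivAt (fun y : R3 => k ‖y‖) (k' • ‖x‖⁻¹ • innerSL ℝ x) x :=
  hk.comp_hasFDerivAt x (hasFDerivAt_norm_of_ne_zero hx)

end Calculus

/-- A field `k(|x|) (x × e₁)` is divergence free. -/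
theorem div3_radial_smul_cross3 {k : ℝ → ℝ} {x : R3} (hx : x ≠ 0)
    (hk : DifferentiableAt ℝ k ‖x‖) : div3 (fun y => k ‖y‖ • cross3 y e1) x = 0 := by
  have hkx := hasFDerivAt_radial hx hk.hasDerivAt
  have h0 : (fun y : R3 => (k ‖y‖ • cross3 y e1) 0) = fun _ => 0 := by
    funext y; simp [cross3, e1]
  have h1 : (fun y : R3 => (k ‖y‖ • cross3 y e1) 1) = fun y => k ‖y‖ * y 2 := by
    funext y; simp [cross3, e1]
  have h2 : (fun y : R3 => (k ‖y‖ • cross3 y e1) 2) = fun y => -(k ‖y‖ * y 1) := by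
    funext y; simp [cross3, e1]
  rw [div3, h0, h1, h2, pd_eq_of_hasFDerivAt (hasFDerivAt_const 0 x),
    pd_eq_of_hasFDerivAt (hkx.fun_mul (hasFDerivAt_coord x 2)),
    pd_eq_of_hasFDerivAt (hkx.fun_mul (hasFDerivAt_coord x 1)).fun_neg]
  simp [EuclideanSpace.inner_single_right]
  ring

/-- The divergence of `F(|x|) (x × (x × e₁)) + K(|x|) e₁`. -/
theorem div3_radial_smul_cross3_cross3 {F K : ℝ → ℝ} {K' : ℝ} {x : R3} (hx : x ≠ 0)
    (hF : DifferentiableAt ℝ F ‖x‖) (hK : HasDerivAt K K' ‖x‖) :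
    div3 (fun y => F ‖y‖ • cross3 y (cross3 y e1) + K ‖y‖ • e1) x =
      x 0 * (2 * F ‖x‖ + K' / ‖x‖) := by
  have hFx := hasFDerivAt_radial hx hF.hasDerivAt
  have hKx := hasFDerivAt_radial hx hK
  have hc := hasFDerivAt_coord x
  have h0 : (fun y : R3 => (F ‖y‖ • cross3 y (cross3 y e1) + K ‖y‖ • e1) 0) =
      fun y => K ‖y‖ - F ‖y‖ * (y 1 * y 1 + y 2 * y 2) := by
    funext y; simp [cross3, e1]; ring
  have h1 : (fun y : R3 => (F ‖y‖ • cross3 y (cross3 y e1) + K ‖y‖ • e1) 1) =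
      fun y => F ‖y‖ * (y 0 * y 1) := by
    funext y; simp [cross3, e1]
  have h2 : (fun y : R3 => (F ‖y‖ • cross3 y (cross3 y e1) + K ‖y‖ • e1) 2) =
      fun y => F ‖y‖ * (y 0 * y 2) := by
    funext y; simp [cross3, e1]
  rw [div3, h0, h1, h2, pd_eq_of_hasFDerivAt
      (hKx.fun_sub (hFx.fun_mul (((hc 1).fun_mul (hc 1)).fun_add ((hc 2).fun_mul (hc 2))))),
    pd_eq_of_hasFDerivAt (hFx.fun_mul ((hc 0).fun_mul (hc 1))),
    pd_eq_of_hasFDerivAt (hFx.fun_mul ((hc 0).fun_mul (hc 2)))]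
  simp [EuclideanSpace.inner_single_right]
  ring

theorem cross3_smul_left (c : ℝ) (u v : R3) : cross3 (c • u) v = c • cross3 u v := by
  ext i
  fin_cases i <;> simp [cross3] <;> ring

theorem cross3_smul_right (c : ℝ) (u v : R3) : cross3 u (c • v) = c • cross3 u v := by
  ext i
  fin_cases i <;> simp [cross3] <;> ring

/-- The fields `E`, `B` built from a `C³` profile `h` are divergence free on `ℝ³ \ {0}`. -/
theorem divergence_free_EB (h : ℝ → ℝ) (hh : ContDiff ℝ 3 h) (t : ℝ)
    (x : R3) (hx : x ≠ 0) :
    div3 (Efield h t) x = 0 ∧ div3 (Bfield h t) x = 0 := by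
  have hr : ‖x‖ ≠ 0 := norm_ne_zero_iff.mpr hx
  have hh' : ContDiff ℝ 2 (deriv h) := ContDiff.deriv' hh
  have hh'' : ContDiff ℝ 1 (deriv (deriv h)) := ContDiff.deriv' hh'
  have c0 : Differentiable ℝ h := hh.differentiable (by norm_num)
  have d0 : HasDerivAt (fun r => h (r + t)) (deriv h (‖x‖ + t)) ‖x‖ :=
    (c0 _).hasDerivAt.comp_add_const _ _
  have d1 : HasDerivAt (fun r => deriv h (r + t)) (deriv (deriv h) (‖x‖ + t)) ‖x‖ :=
    ((hh'.differentiable (by norm_num)) _).hasDerivAt.comp_add_const _ _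
  have d2 : DifferentiableAt ℝ (fun r => deriv (deriv h) (r + t)) ‖x‖ :=
    (((hh''.differentiable (by norm_num)) _).hasDerivAt.comp_add_const _ _).differentiableAt
  have c1 := d1.differentiableAt
  constructor
  · let k : ℝ → ℝ := fun r => (deriv (deriv h) (r + t) / r - deriv h (r + t) / r ^ 2) * r⁻¹
    have hk : DifferentiableAt ℝ k ‖x‖ := by
      simp only [k]
      fun_prop (disch := simpa using hx)
    have hE : Efield h t = fun y => k ‖y‖ • cross3 y e1 := by
      funext y
      simp only [Efield, cross3_smul_left, smul_smul, k]
    rw [hE]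
    exact div3_radial_smul_cross3 hx hk
  · let F : ℝ → ℝ := fun r => -(deriv (deriv h) (r + t) / r - 3 * deriv h (r + t) / r ^ 2
      + 3 * h (r + t) / r ^ 3) * (r⁻¹ * r⁻¹)
    let K : ℝ → ℝ := fun r => 2 * (deriv h (r + t) / r ^ 2 - h (r + t) / r ^ 3)
    have hF : DifferentiableAt ℝ F ‖x‖ := by
      simp only [F]
      fun_prop (disch := simpa using hx)
    have hK : HasDerivAt K _ ‖x‖ :=
      ((d1.fun_div (hasDerivAt_pow 2 ‖x‖) (pow_ne_zero 2 hr)).fun_sub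
        (d0.fun_div (hasDerivAt_pow 3 ‖x‖) (pow_ne_zero 3 hr))).const_mul 2
    have hB : Bfield h t = fun y => F ‖y‖ • cross3 y (cross3 y e1) + K ‖y‖ • e1 := by
      funext y
      simp only [Bfield, cross3_smul_left, cross3_smul_right, smul_smul, F, K]
    rw [hB, div3_radial_smul_cross3_cross3 hx hF hK]
    simp only [F]
    field_simp
    push_cast
    ring
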